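/- Let a < b and let ξ = (ξ₁, ξ₂) : [a,b] → ℝ × ℝ be continuous with ξ₁(r) ≥ 0, ξ₂(r) ≥ 0 and (ξ₁(r), ξ₂(r)) ≠ (0,0) for all r ∈ [a,b], and with ξ(a) = (p, 0) and ξ(b) = (0, q) for some p, q > 0. Let c > 0 be such that max(ξ₁(r), ξ₂(r)) ≥ c for all r ∈ [a,b]. Then for every τ > 0, the number of pairs (m,n) of nonnegative integers with (m,n) ≠ (0,0) for which there exist r ∈ [a,b] and T ∈ (0,τ) with T·ξ₁(r) = m and T·ξ₂(r) = n is at least c²·τ² − 1. -/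

import Mathlib

/-- A continuous path in the closed quadrant from the positive first axis to the positive second
axis meets every nonnegative integer direction; the time needed to reach `(m, n)` is less than `τ`
as soon as both `m` and `n` are less than `c * τ`. -/
theorem exists_time_mul_eq_natCast {a b : ℝ} (hab : a ≤ b) {ξ₁ ξ₂ : ℝ → ℝ}
    (hc1 : ContinuousOn ξ₁ (Set.Icc a b)) (hc2 : ContinuousOn ξ₂ (Set.Icc a b))
    (hnn1 : ∀ r ∈ Set.Icc a b, 0 ≤ ξ₁ r) (hnn2 : ∀ r ∈ Set.Icc a b, 0 ≤ ξ₂ r)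
    (ha1 : 0 ≤ ξ₁ a) (ha2 : ξ₂ a = 0) (hb1 : ξ₁ b = 0) (hb2 : 0 ≤ ξ₂ b)
    {c : ℝ} (hcpos : 0 < c) (hc : ∀ r ∈ Set.Icc a b, c ≤ max (ξ₁ r) (ξ₂ r))
    {τ : ℝ} {m n : ℕ} (hmn : 0 < m + n) (hm : (m : ℝ) < c * τ) (hn : (n : ℝ) < c * τ) :
    ∃ r ∈ Set.Icc a b, ∃ T ∈ Set.Ioo (0 : ℝ) τ, T * ξ₁ r = m ∧ T * ξ₂ r = n := by
  have hcont : ContinuousOn (fun r => n * ξ₁ r - m * ξ₂ r) (Set.Icc a b) :=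
    (continuousOn_const.mul hc1).sub (continuousOn_const.mul hc2)
  have hzero : (0 : ℝ) ∈ Set.Icc (n * ξ₁ b - m * ξ₂ b) (n * ξ₁ a - m * ξ₂ a) := by
    rw [hb1, ha2]
    constructor
    · have : 0 ≤ m * ξ₂ b := by positivity
      linarith
    · have : 0 ≤ n * ξ₁ a := by positivity
      linarith
  obtain ⟨r, hr, hgr⟩ := intermediate_value_Icc' hab hcont hzero
  have hdir : n * ξ₁ r = m * ξ₂ r := sub_eq_zero.mp hgr
  have h1 := hnn1 r hr
  have h2 := hnn2 r hr
  have hs : 0 < ξ₁ r + ξ₂ r := by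
    rcases le_max_iff.mp (hc r hr) with h | h <;> linarith
  have hmn' : (0 : ℝ) < m + n := by exact_mod_cast hmn
  have hT1 : (m + n) / (ξ₁ r + ξ₂ r) * ξ₁ r = m := by
    field_simp
    linarith
  have hT2 : (m + n) / (ξ₁ r + ξ₂ r) * ξ₂ r = n := by
    field_simp
    linarith
  have hT : 0 < (m + n) / (ξ₁ r + ξ₂ r) := by positivity
  refine ⟨r, hr, _, ⟨hT, ?_⟩, hT1, hT2⟩
  rcases le_max_iff.mp (hc r hr) with h | h <;> nlinarith

/-- Bounded time and bounded speed reach only finitely many integer points. -/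
theorem finite_setOf_time_mul_eq_natCast {a b : ℝ} {ξ₁ ξ₂ : ℝ → ℝ}
    (hc1 : ContinuousOn ξ₁ (Set.Icc a b)) (hc2 : ContinuousOn ξ₂ (Set.Icc a b)) (τ : ℝ) :
    {mn : ℕ × ℕ | mn ≠ 0 ∧ ∃ r ∈ Set.Icc a b, ∃ T ∈ Set.Ioo (0 : ℝ) τ,
      T * ξ₁ r = (mn.1 : ℝ) ∧ T * ξ₂ r = (mn.2 : ℝ)}.Finite := by
  obtain ⟨M₁, hM₁⟩ := isCompact_Icc.exists_bound_of_continuousOn hc1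
  obtain ⟨M₂, hM₂⟩ := isCompact_Icc.exists_bound_of_continuousOn hc2
  have bound {T x M : ℝ} (hT : T ∈ Set.Ioo 0 τ) (hx : ‖x‖ ≤ M) : T * x ≤ τ * M :=
    (mul_le_mul_of_nonneg_left ((le_abs_self x).trans hx) hT.1.le).trans
      (mul_le_mul_of_nonneg_right hT.2.le ((norm_nonneg x).trans hx))
  refine (Set.finite_Iic (⌊τ * M₁⌋₊, ⌊τ * M₂⌋₊)).subset ?_
  rintro ⟨m, n⟩ ⟨-, r, hr, T, hT, h1, h2⟩
  exact ⟨Nat.le_floor (h1 ▸ bound hT (hM₁ r hr)), Nat.le_floor (h2 ▸ bound hT (hM₂ r hr))⟩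

/-- For a continuous speed function `ξ = (ξ₁,ξ₂)` on `[a,b]`
interpolating from `(p,0)` to `(0,q)`, nowhere vanishing, with
`max(ξ₁,ξ₂) ≥ c > 0`, the number of nonzero pairs of nonnegative integers
`(m,n)` realized as `(T·ξ₁(r), T·ξ₂(r))` with `r ∈ [a,b]`, `T ∈ (0,τ)` is at
least `c²τ² - 1`. -/
theorem periodic_tori_lower_bound
    (a b : ℝ) (hab : a < b) (ξ₁ ξ₂ : ℝ → ℝ)
    (hc1 : ContinuousOn ξ₁ (Set.Icc a b)) (hc2 : ContinuousOn ξ₂ (Set.Icc a b))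
    (hnn1 : ∀ r ∈ Set.Icc a b, 0 ≤ ξ₁ r) (hnn2 : ∀ r ∈ Set.Icc a b, 0 ≤ ξ₂ r)
    (hnz : ∀ r ∈ Set.Icc a b, (ξ₁ r, ξ₂ r) ≠ (0, 0))
    (p q : ℝ) (hp : 0 < p) (hq : 0 < q)
    (ha : ξ₁ a = p ∧ ξ₂ a = 0) (hb : ξ₁ b = 0 ∧ ξ₂ b = q)
    (c : ℝ) (hcpos : 0 < c) (hc : ∀ r ∈ Set.Icc a b, c ≤ max (ξ₁ r) (ξ₂ r)) :
    ∀ τ : ℝ, 0 < τ →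
      c ^ 2 * τ ^ 2 - 1 ≤
        (({mn : ℕ × ℕ | mn ≠ 0 ∧ ∃ r ∈ Set.Icc a b, ∃ T ∈ Set.Ioo (0 : ℝ) τ,
            T * ξ₁ r = (mn.1 : ℝ) ∧ T * ξ₂ r = (mn.2 : ℝ)}).ncard : ℝ) := by
  intro τ hτ
  set N := ⌈c * τ⌉₊
  have hsub : (((Finset.range N ×ˢ Finset.range N).erase 0 : Finset (ℕ × ℕ)) : Set (ℕ × ℕ)) ⊆
      {mn : ℕ × ℕ | mn ≠ 0 ∧ ∃ r ∈ Set.Icc a b, ∃ T ∈ Set.Ioo (0 : ℝ) τ,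
        T * ξ₁ r = (mn.1 : ℝ) ∧ T * ξ₂ r = (mn.2 : ℝ)} := by
    rintro ⟨m, n⟩ hmn
    simp only [Finset.coe_erase, Set.mem_sdiff, Finset.mem_coe, Finset.mem_product,
      Finset.mem_range, Set.mem_singleton_iff] at hmn
    obtain ⟨⟨hm, hn⟩, hne⟩ := hmn
    refine ⟨hne, exists_time_mul_eq_natCast hab.le hc1 hc2 hnn1 hnn2 (by linarith) ha.2 hb.1
      (by linarith) hcpos hc ?_ (Nat.lt_ceil.mp hm) (Nat.lt_ceil.mp hn)⟩
    rw [Prod.mk_eq_zero] at hne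
    omega
  have hcard := Set.ncard_le_ncard hsub (finite_setOf_time_mul_eq_natCast hc1 hc2 τ)
  rw [Set.ncard_coe_finset] at hcard
  have hle : N * N ≤ ((Finset.range N ×ˢ Finset.range N).erase (0 : ℕ × ℕ)).card + 1 := by
    have := Finset.pred_card_le_card_erase (s := Finset.range N ×ˢ Finset.range N)
      (a := (0 : ℕ × ℕ))
    rw [Finset.card_product, Finset.card_range] at this
    omega
  have hN := hle.trans (Nat.add_le_add_right hcard 1)
  rw [← Nat.cast_le (α := ℝ)] at hN
  push_cast at hN
  have hceil : c * τ ≤ N := Nat.le_ceil _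
  have hpos : 0 < c * τ := mul_pos hcpos hτ
  nlinarith [mul_le_mul hceil hceil hpos.le (hpos.le.trans hceil)]
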